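/- Let A be a finite abelian group of odd order. Then the assignment sending a quadratic form q on A to its associated symmetric bicharacter ⟨a,b⟩_q := q(a+b)·q(a)⁻¹·q(b)⁻¹ is a bijection from the set of quadratic forms on A to the set of symmetric bicharacters on A. -/

import Mathlib

/-- The bicharacter associated to a function `q : A → kˣ`:
`⟨a,b⟩_q := q(a+b) · q(a)⁻¹ · q(b)⁻¹`. -/
def assocBichar {k : Type*} [Field k] {A : Type*} [AddCommGroup A]
    (q : A → kˣ) : A → A → kˣ :=
  fun a b => q (a + b) * (q a)⁻¹ * (q b)⁻¹

/-- A quadratic form on a finite abelian group `A` valued in `kˣ`: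
`q(-a) = q(a)` and the associated form is additive in each variable. -/
def IsQuadraticForm {k : Type*} [Field k] {A : Type*} [AddCommGroup A]
    (q : A → kˣ) : Prop :=
  (∀ a, q (-a) = q a) ∧
  (∀ a₁ a₂ b, assocBichar q (a₁ + a₂) b = assocBichar q a₁ b * assocBichar q a₂ b) ∧
  (∀ a b₁ b₂, assocBichar q a (b₁ + b₂) = assocBichar q a b₁ * assocBichar q a b₂)

/-- A symmetric bicharacter on `A` valued in `kˣ`. -/
def IsSymmBicharacter {k : Type*} [Field k] {A : Type*} [AddCommGroup A]
    (b : A → A → kˣ) : Prop :=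
  (∀ a₁ a₂ c, b (a₁ + a₂) c = b a₁ c * b a₂ c) ∧
  (∀ a c₁ c₂, b a (c₁ + c₂) = b a c₁ * b a c₂) ∧
  (∀ a c, b a c = b c a)

theorem quad_two_mul_eq {k : Type*} [Field k] {A : Type*} [AddCommGroup A]
    (q : A → kˣ) (hq : IsQuadraticForm q) (c : A) :
    q (c + c) = assocBichar q c c * assocBichar q c c := by
  obtain ⟨h1, h2, h3⟩ := hq
  have h0 : assocBichar q 0 0 = 1 := by
    have h := h2 0 0 0
    rw [add_zero] at h
    exact left_eq_mul.mp h
  have hq0 : q 0 = 1 := by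
    simpa [assocBichar] using h0
  have hc0 : assocBichar q c 0 = 1 := by
    simp [assocBichar, hq0]
  have h4 := h3 c c (-c)
  rw [add_neg_cancel, hc0] at h4
  have h5 : assocBichar q c (-c) = (q c)⁻¹ * (q c)⁻¹ := by
    simp [assocBichar, hq0, h1]
  rw [h5] at h4
  have h6 : assocBichar q c c = q c * q c := by
    rw [← mul_inv, eq_comm, mul_inv_eq_one] at h4
    exact h4
  have h7 : q (c + c) = assocBichar q c c * (q c * q c) := by
    simp only [assocBichar]
    rw [mul_assoc (q (c + c)), ← mul_inv, inv_mul_cancel_right]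
  rw [h7, ← h6]

/-- For a finite abelian group `A` of odd order, the assignment
`q ↦ ⟨·,·⟩_q` is a bijection from quadratic forms on `A` to symmetric
bicharacters on `A`. -/
theorem quadForm_to_symmBicharacter_bijective
    (k : Type*) [Field k] [IsAlgClosed k] [CharZero k]
    (A : Type*) [AddCommGroup A] [Fintype A]
    (hodd : Odd (Fintype.card A)) :
    Set.BijOn (fun q : A → kˣ => assocBichar q)
      {q | IsQuadraticForm q} {b | IsSymmBicharacter b} := by
  obtain ⟨m, hm⟩ := hodd
  refine ⟨?_, ?_, ?_⟩
  · intro q hq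
    refine ⟨hq.2.1, hq.2.2, fun a c => ?_⟩
    simp only [assocBichar]
    rw [add_comm a c, mul_right_comm]
  · intro q hq r hr h
    have h : assocBichar q = assocBichar r := h
    funext a
    have ha : (m + 1) • a + (m + 1) • a = a := by
      have h1 : (2 * m + 1) • a = 0 := by rw [← hm]; exact card_nsmul_eq_zero
      rw [← add_nsmul, show m + 1 + (m + 1) = (2 * m + 1) + 1 by ring, add_nsmul, h1,
        zero_add, one_nsmul]
    rw [← ha, quad_two_mul_eq q hq, quad_two_mul_eq r hr, h]
  · intro b hb
    obtain ⟨h1, h2, h3⟩ := hb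
    have h0 : ∀ y, b 0 y = 1 := fun y => by
      have h := h1 0 0 y
      rw [add_zero] at h
      exact left_eq_mul.mp h
    have hn : ∀ (n : ℕ) (x y : A), b (n • x) y = b x y ^ n := by
      intro n x y
      induction n with
      | zero => simp [h0]
      | succ n ih => rw [add_nsmul, one_nsmul, h1, ih, pow_succ]
    have ht : ∀ x y, b x y ^ (2 * m + 1) = 1 := fun x y => by
      rw [← hn, ← hm, card_nsmul_eq_zero, h0]
    have hneg : ∀ x y, b (-x) y = (b x y)⁻¹ := fun x y => by
      rw [eq_inv_iff_mul_eq_one, ← h1, neg_add_cancel, h0]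
    have key : assocBichar (fun a => b a a ^ (m + 1)) = b := by
      funext x y
      simp only [assocBichar]
      have e : b (x + y) (x + y) = b x y ^ 2 * (b y y * b x x) := by
        rw [h1, h2, h2, h3 y x, pow_two]
        simp only [mul_assoc, mul_comm, mul_left_comm]
      have e2 : (b x y ^ 2) ^ (m + 1) = b x y := by
        rw [← pow_mul, show 2 * (m + 1) = (2 * m + 1) + 1 by ring, pow_succ, ht, one_mul]
      rw [e, mul_pow, e2, mul_pow, mul_assoc, mul_assoc, ← mul_inv,
        mul_comm (b x x ^ (m + 1)), mul_inv_cancel, mul_one]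
    refine ⟨fun a => b a a ^ (m + 1), ⟨fun a => ?_, ?_, ?_⟩, key⟩
    · simp only []
      rw [hneg, h3 a (-a), hneg, inv_inv]
    · rw [key]; exact h1
    · rw [key]; exact h2
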